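/- Let w : ℕ → ℝ be nonnegative with ∑_{k=2}^∞ w_k < ∞. Then the function R ↦ ∑_{k=2}^∞ w_k · (1 − B_k(R)/k), where B_k(R) = (R^k − (R−1)^k)/R^{k−1}, is antitone (non-increasing) on the real interval [1, ∞). -/

import Mathlib

/-- The ratio `B_{n+1}(R)` is a geometric sum in `1 - 1/R`. -/
theorem pow_sub_pow_div_eq_geom_sum {R : ℝ} (hR : R ≠ 0) (n : ℕ) :
    (R ^ (n + 1) - (R - 1) ^ (n + 1)) / R ^ n =
      ∑ i ∈ Finset.range (n + 1), (1 - R⁻¹) ^ i := by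
  have hmul : R - 1 = R * (1 - R⁻¹) := by field_simp
  have hgeom := mul_neg_geom_sum (1 - R⁻¹) (n + 1)
  rw [sub_sub_cancel, inv_mul_eq_iff_eq_mul₀ hR] at hgeom
  rw [hgeom, hmul, mul_pow, div_eq_iff (pow_ne_zero n hR)]
  ring

theorem one_sub_inv_mem_Icc {R : ℝ} (hR : 1 ≤ R) : 1 - R⁻¹ ∈ Set.Icc (0 : ℝ) 1 :=
  ⟨sub_nonneg.2 (inv_le_one_of_one_le₀ hR),
    sub_le_self _ (inv_nonneg.2 (zero_le_one.trans hR))⟩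

/-- `1 - B_k(R)/k` lies in `[0, 1]`. -/
theorem one_sub_geom_sum_div_mem_Icc {x : ℝ} (hx : x ∈ Set.Icc (0 : ℝ) 1) (k : ℕ) :
    1 - (∑ i ∈ Finset.range (k + 2), x ^ i) / ((k : ℝ) + 2) ∈ Set.Icc (0 : ℝ) 1 := by
  have hk : (0 : ℝ) < (k : ℝ) + 2 := by positivity
  have hnonneg : 0 ≤ ∑ i ∈ Finset.range (k + 2), x ^ i :=
    Finset.sum_nonneg fun i _ => pow_nonneg hx.1 i
  have hle : ∑ i ∈ Finset.range (k + 2), x ^ i ≤ (k : ℝ) + 2 := by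
    simpa using Finset.sum_le_card_nsmul (Finset.range (k + 2)) (fun i => x ^ i) 1
      fun i _ => pow_le_one₀ hx.1 hx.2
  exact ⟨sub_nonneg.2 ((div_le_one hk).2 hle), sub_le_self _ (div_nonneg hnonneg hk.le)⟩

/-- **Corollary 1: the collision lower bound decreases with the number of preambles.**
For nonnegative weights `w` with `∑_{k=2}^∞ w_k < ∞`, the function
`R ↦ ∑_{k=2}^∞ w_k·(1 − B_k(R)/k)`, where `B_k(R) = (R^k − (R−1)^k)/R^{k−1}`,
is non-increasing on `[1, ∞)`. -/
theorem collision_lower_bound_antitone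
    (w : ℕ → ℝ) (hw : ∀ k, 0 ≤ w k) (hsum : Summable (fun k => w (k + 2))) :
    AntitoneOn
      (fun R : ℝ => ∑' k : ℕ,
        w (k + 2) * (1 - ((R ^ (k + 2) - (R - 1) ^ (k + 2)) / R ^ (k + 1)) / ((k : ℝ) + 2)))
      (Set.Ici 1) := by
  have hB : ∀ R ∈ Set.Ici (1 : ℝ), ∀ k : ℕ,
      (R ^ (k + 2) - (R - 1) ^ (k + 2)) / R ^ (k + 1) =
        ∑ i ∈ Finset.range (k + 2), (1 - R⁻¹) ^ i := fun R hR k =>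
    pow_sub_pow_div_eq_geom_sum (zero_lt_one.trans_le hR).ne' (k + 1)
  have hs : ∀ R ∈ Set.Ici (1 : ℝ), Summable fun k : ℕ =>
      w (k + 2) * (1 - ((R ^ (k + 2) - (R - 1) ^ (k + 2)) / R ^ (k + 1)) / ((k : ℝ) + 2)) := by
    intro R hR
    have hmem := one_sub_geom_sum_div_mem_Icc (one_sub_inv_mem_Icc hR)
    simp only [hB R hR]
    exact hsum.of_nonneg_of_le (fun k => mul_nonneg (hw _) (hmem k).1)
      fun k => mul_le_of_le_one_right (hw _) (hmem k).2
  intro R hR S hS hRS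
  refine (hs S hS).tsum_le_tsum (fun k => ?_) (hs R hR)
  rw [hB R hR, hB S hS]
  have hx := (one_sub_inv_mem_Icc hR).1
  have hxy : 1 - R⁻¹ ≤ 1 - S⁻¹ :=
    sub_le_sub_left (inv_anti₀ (zero_lt_one.trans_le hR) hRS) 1
  refine mul_le_mul_of_nonneg_left (sub_le_sub_left ?_ 1) (hw _)
  gcongr
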